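/- Let H be a real normed space and S : H → H a continuous compact map. Suppose there exists R > 0 such that every solution of u = t·S(u) with t ∈ [0, 1] satisfies ‖u‖ < R. Then S has a fixed point. -/

import Mathlib

open Set Metric MeasureTheory Polynomial
open scoped Topology

theorem exists_polynomial_det_id_add_smul {E : Type*} [NormedAddCommGroup E] [NormedSpace ℝ E]
    [FiniteDimensional ℝ E] (A : E →L[ℝ] E) :
    ∃ p : ℝ[X], p.natDegree ≤ Module.finrank ℝ E ∧
      ∀ t : ℝ, p.eval t = (ContinuousLinearMap.id ℝ E + t • A).det := by
  let b := Module.finBasis ℝ E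
  let M := LinearMap.toMatrix b b (A : E →ₗ[ℝ] E)
  refine ⟨((X : ℝ[X]) • M.map C + (1 : Matrix _ _ ℝ).map C).det, ?_, fun t => ?_⟩
  · simpa using natDegree_det_X_add_C_le M 1
  · have h : (evalRingHom t).mapMatrix ((X : ℝ[X]) • M.map C + (1 : Matrix _ _ ℝ).map C) =
        LinearMap.toMatrix b b (LinearMap.id + t • (A : E →ₗ[ℝ] E)) := by
      ext i j
      simp [M, Matrix.one_apply, add_comm, apply_ite]
      exact mul_comm _ _
    rw [← coe_evalRingHom, RingHom.map_det, h, LinearMap.det_toMatrix]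
    simp [ContinuousLinearMap.det]

theorem ContinuousLinearMap.det_id_add_smul_pos {E : Type*} [NormedAddCommGroup E]
    [NormedSpace ℝ E] [FiniteDimensional ℝ E] {A : E →L[ℝ] E} {t : ℝ} (ht : 0 ≤ t)
    (hA : t * ‖A‖ < 1) : 0 < (ContinuousLinearMap.id ℝ E + t • A).det := by
  obtain ⟨p, -, hp⟩ := exists_polynomial_det_id_add_smul A
  have hne : ∀ s ∈ Icc 0 t, p.eval s ≠ 0 := by
    intro s hs h0
    rw [hp] at h0
    obtain ⟨v, hv, hv0⟩ := (Submodule.ne_bot_iff _).1 (LinearMap.bot_lt_ker_of_det_eq_zero h0).ne'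
    have hv' : v = -(s • A v) := eq_neg_of_add_eq_zero_left (by simpa using hv)
    have h1 : ‖v‖ ≤ t * ‖A‖ * ‖v‖ := calc
      ‖v‖ = s * ‖A v‖ := by
        conv_lhs => rw [hv', norm_neg, norm_smul, Real.norm_of_nonneg hs.1]
      _ ≤ t * (‖A‖ * ‖v‖) := by
        gcongr
        exacts [hs.2, A.le_opNorm v]
      _ = _ := by ring
    nlinarith [norm_pos_iff.2 hv0]
  rw [← hp]
  by_contra! hneg
  have h0 : p.eval 0 = 1 := by simp [hp, ContinuousLinearMap.det]
  obtain ⟨s, hs, hs0⟩ := intermediate_value_Icc' ht p.continuous.continuousOn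
    (show (0 : ℝ) ∈ Icc (p.eval t) (p.eval 0) from ⟨hneg, by simp [h0]⟩)
  exact hne s hs hs0

theorem image_ball_eq_ball {E : Type*} [NormedAddCommGroup E] [NormedSpace ℝ E]
    [FiniteDimensional ℝ E] {f : E → E}
    (hf : ∀ x ∈ ball (0 : E) 1, Filter.map f (𝓝 x) = 𝓝 (f x))
    (hc : ContinuousOn f (closedBall 0 1))
    (hmaps : MapsTo f (ball 0 1) (ball 0 1)) (hid : ∀ x ∈ sphere (0 : E) 1, f x = x) :
    f '' ball 0 1 = ball 0 1 := by
  refine hmaps.image_subset.antisymm ?_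
  refine (convex_ball (0 : E) 1).isPreconnected.subset_of_closure_inter_subset ?_ ?_ ?_
  · refine isOpen_iff_mem_nhds.2 ?_
    rintro _ ⟨x, hx, rfl⟩
    rw [← hf x hx]
    exact Filter.image_mem_map (isOpen_ball.mem_nhds hx)
  · have h0 : (0 : E) ∈ ball (0 : E) 1 := by simp
    exact ⟨f 0, hmaps h0, mem_image_of_mem f h0⟩
  · rintro y ⟨hy, hyb⟩
    have hcl : IsClosed (f '' closedBall 0 1) :=
      ((isCompact_closedBall 0 1).image_of_continuousOn hc).isClosed
    obtain ⟨x, hx, rfl⟩ := closure_minimal (image_mono ball_subset_closedBall) hcl hy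
    rcases (mem_closedBall.1 hx).lt_or_eq with h | h
    · exact mem_image_of_mem f h
    · rw [hid x h, mem_ball] at hyb
      exact absurd hyb (by rw [h]; exact lt_irrefl _)

/-- The integral of the Jacobian of `f` over the unit ball depends on the boundary values only:
along the segment from `id` to `f` it is polynomial in the parameter, and constant near `id`. -/
theorem integral_det_fderiv_ball_eq {E : Type*} [NormedAddCommGroup E] [NormedSpace ℝ E]
    [FiniteDimensional ℝ E] [MeasurableSpace E] [BorelSpace E] (μ : Measure E)
    [μ.IsAddHaarMeasure] {f : E → E} (hf : ∀ x ∈ closedBall (0 : E) 1, ContDiffAt ℝ 1 f x)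
    (hmaps : MapsTo f (closedBall 0 1) (closedBall 0 1))
    (hid : ∀ x ∈ sphere (0 : E) 1, f x = x) :
    ∫ x in ball (0 : E) 1, (fderiv ℝ f x).det ∂μ = μ.real (ball 0 1) := by
  set B := closedBall (0 : E) 1
  set A : E → E →L[ℝ] E := fun x => fderiv ℝ f x - ContinuousLinearMap.id ℝ E with hA
  have hAc : ContinuousOn A B := fun x hx =>
    (((hf x hx).continuousAt_fderiv one_ne_zero).sub continuousAt_const).continuousWithinAt
  obtain ⟨C, hC⟩ := (isCompact_closedBall (0 : E) 1).exists_bound_of_continuousOn hAc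
  have hC0 : 0 ≤ C := (norm_nonneg _).trans (hC 0 (by simp))
  set δ := (C + 1)⁻¹ with hδ
  have hδ0 : 0 < δ := by positivity
  have hδC : ∀ t ∈ Ico 0 δ, t * C < 1 := fun t ht => by
    have h1 : δ * (C + 1) = 1 := inv_mul_cancel₀ (by positivity)
    nlinarith [ht.1, ht.2]
  have hδ1 : δ ≤ 1 := inv_le_one_of_one_le₀ (by linarith)
  set g : E → E := fun x => f x - x with hg
  have hgd : ∀ x ∈ B, HasFDerivAt g (A x) x := fun x hx =>
    ((hf x hx).differentiableAt one_ne_zero).hasFDerivAt.sub (hasFDerivAt_id x)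
  have hgl : ∀ x ∈ B, ∀ y ∈ B, ‖g y - g x‖ ≤ C * ‖y - x‖ := fun x hx y hy =>
    (convex_closedBall (0 : E) 1).norm_image_sub_le_of_norm_hasFDerivWithin_le
      (fun z hz => (hgd z hz).hasFDerivWithinAt) hC hx hy
  have hderiv : ∀ t : ℝ, ∀ x ∈ B, HasFDerivAt (fun x => x + t • g x)
      (ContinuousLinearMap.id ℝ E + t • A x) x := fun t x hx =>
    (hasFDerivAt_id x).add ((hgd x hx).const_smul t)
  have hdet : ∀ t ∈ Ico 0 δ, ∀ x ∈ B, 0 < (ContinuousLinearMap.id ℝ E + t • A x).det :=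
    fun t ht x hx => ContinuousLinearMap.det_id_add_smul_pos ht.1
      ((mul_le_mul_of_nonneg_left (hC x hx) ht.1).trans_lt (hδC t ht))
  have hball : ball (0 : E) 1 ⊆ B := ball_subset_closedBall
  have hcont : ∀ t : ℝ, ContinuousOn (fun x => (ContinuousLinearMap.id ℝ E + t • A x).det) B :=
    fun t => ContinuousLinearMap.continuous_det.comp_continuousOn
      (continuousOn_const.add (hAc.const_smul t))
  have hint : ∀ t : ℝ,
      IntegrableOn (fun x => (ContinuousLinearMap.id ℝ E + t • A x).det) (ball 0 1) μ :=
    fun t => ((hcont t).integrableOn_compact (isCompact_closedBall _ _)).mono_set hball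
  have hsmall : ∀ t ∈ Ico 0 δ,
      ∫ x in ball (0 : E) 1, (ContinuousLinearMap.id ℝ E + t • A x).det ∂μ
        = μ.real (ball 0 1) := by
    intro t ht
    have himg : (fun x => x + t • g x) '' ball 0 1 = ball 0 1 := by
      refine image_ball_eq_ball (fun x hx => ?_)
        (fun x hx => (hderiv t x hx).continuousAt.continuousWithinAt) (fun x hx => ?_)
        (fun x hx => by simp [hg, hid x hx])
      · have hcd : ContDiffAt ℝ 1 (fun x => x + t • g x) x :=
          contDiffAt_id.add (((hf x (hball hx)).sub contDiffAt_id).const_smul t)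
        have hs := hcd.hasStrictFDerivAt' (hderiv t x (hball hx)) one_ne_zero
        refine hs.map_nhds_eq_of_surj ?_
        exact LinearMap.range_eq_top.2
          (LinearMap.equivOfDetNeZero _ (hdet t ht x (hball hx)).ne').surjective
      · have hx1 : ‖x‖ < 1 := by simpa using hx
        have hf1 : ‖f x‖ ≤ 1 := mem_closedBall_zero_iff.1 (hmaps (hball hx))
        have ht1 : t < 1 := ht.2.trans_le hδ1
        have : x + t • g x = (1 - t) • x + t • f x := by simp only [hg]; module
        rw [mem_ball_zero_iff, this]
        refine (norm_add_le _ _).trans_lt ?_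
        rw [norm_smul, norm_smul, Real.norm_of_nonneg ht.1, Real.norm_of_nonneg (by linarith)]
        nlinarith [ht.1]
    have hinj : InjOn (fun x => x + t • g x) (ball 0 1) := by
      intro x hx y hy hxy
      have h1 : y - x = -(t • (g y - g x)) := by
        simp only at hxy
        have : y - x - -(t • (g y - g x)) = (y + t • g y) - (x + t • g x) := by module
        rw [← sub_eq_zero, this, hxy, sub_self]
      have h2 : ‖y - x‖ ≤ t * (C * ‖y - x‖) := by
        conv_lhs => rw [h1, norm_neg, norm_smul, Real.norm_of_nonneg ht.1]
        exact mul_le_mul_of_nonneg_left (hgl x (hball hx) y (hball hy)) ht.1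
      by_contra hne
      have := norm_pos_iff.2 (sub_ne_zero.2 (Ne.symm hne))
      nlinarith [hδC t ht]
    have := integral_image_eq_integral_abs_det_fderiv_smul μ measurableSet_ball
      (fun x hx => (hderiv t x (hball hx)).hasFDerivWithinAt) hinj (fun _ => (1 : ℝ))
    rw [himg] at this
    simp only [smul_eq_mul, mul_one, integral_const, measureReal_restrict_apply_univ] at this
    rw [this]
    refine setIntegral_congr_fun measurableSet_ball fun x hx => ?_
    exact (abs_of_pos (hdet t ht x (hball hx))).symm
  let N := Module.finrank ℝ E + 1
  let v : ℕ → ℝ := fun j => δ / (j + 2)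
  have hvinj : InjOn v (Finset.range N : Set ℕ) := by
    intro i _ j _ hij
    simp only [v] at hij
    field_simp at hij
    exact_mod_cast (by linarith : (i : ℝ) = j)
  have hv : ∀ j, v j ∈ Ico 0 δ := fun j =>
    ⟨by positivity, div_lt_self hδ0 (by have : (0 : ℝ) ≤ j := j.cast_nonneg; linarith)⟩
  have hinterp : ∀ x, (fderiv ℝ f x).det = ∑ j ∈ Finset.range N,
      (ContinuousLinearMap.id ℝ E + v j • A x).det *
        (Lagrange.basis (Finset.range N) v j).eval 1 := by
    intro x
    obtain ⟨p, hdeg, hp⟩ := exists_polynomial_det_id_add_smul (A x)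
    have hlt : p.degree < (Finset.range N).card := by
      rw [Finset.card_range]
      exact degree_le_natDegree.trans_lt (by exact_mod_cast Nat.lt_succ_of_le hdeg)
    have h1 := congrArg (eval 1) (Lagrange.eq_interpolate hvinj hlt)
    rw [hp, Lagrange.interpolate_apply, eval_finsetSum] at h1
    simpa [hp, hA] using h1
  have hsum : ∑ j ∈ Finset.range N, (Lagrange.basis (Finset.range N) v j).eval 1 = 1 := by
    rw [← eval_finsetSum, Lagrange.sum_basis hvinj (by simp [N]), eval_one]
  simp_rw [hinterp]
  rw [integral_finsetSum _ fun j _ => (hint (v j)).mul_const _]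
  simp_rw [integral_mul_const, hsmall _ (hv _), ← Finset.mul_sum, hsum, mul_one]

theorem not_contDiffAt_retraction_sphere {E : Type*} [NormedAddCommGroup E] [InnerProductSpace ℝ E]
    [FiniteDimensional ℝ E] {f : E → E} (hf : ∀ x ∈ closedBall (0 : E) 1, ContDiffAt ℝ 1 f x)
    (hmaps : MapsTo f (closedBall 0 1) (sphere 0 1)) :
    ¬ ∀ x ∈ sphere (0 : E) 1, f x = x := by
  intro hid
  let _ : MeasurableSpace E := borel E
  have : BorelSpace E := ⟨rfl⟩
  have h := integral_det_fderiv_ball_eq volume hf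
    (hmaps.mono_right sphere_subset_closedBall) hid
  have hdet : ∀ x ∈ ball (0 : E) 1, (fderiv ℝ f x).det = 0 := by
    intro x hx
    by_contra hne
    have hd := ((hf x (ball_subset_closedBall hx)).differentiableAt one_ne_zero).hasFDerivAt
    obtain ⟨v, hv⟩ := (LinearMap.equivOfDetNeZero _ hne).surjective (f x)
    have hv' : fderiv ℝ f x v = f x := hv
    have hconst : (fun y => ‖f y‖ ^ 2) =ᶠ[𝓝 x] fun _ => 1 := by
      filter_upwards [isOpen_ball.mem_nhds hx] with y hy
      rw [mem_sphere_zero_iff_norm.1 (hmaps (ball_subset_closedBall hy)), one_pow]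
    have huniq := hd.norm_sq.unique ((hasFDerivAt_const (1 : ℝ) x).congr_of_eventuallyEq hconst)
    have h0 := congrArg (fun L : E →L[ℝ] ℝ => L v) huniq
    have h1 : ‖f x‖ = 1 := mem_sphere_zero_iff_norm.1 (hmaps (ball_subset_closedBall hx))
    simp [hv', h1] at h0
  rw [setIntegral_congr_fun measurableSet_ball hdet, integral_zero] at h
  exact (ENNReal.toReal_pos (measure_ball_pos volume (0 : E) one_pos).ne'
    measure_ball_lt_top.ne).ne h

theorem exists_fixedPoint_of_contDiff {E : Type*} [NormedAddCommGroup E] [InnerProductSpace ℝ E]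
    [FiniteDimensional ℝ E] {g : E → E} (hg : ContDiff ℝ 1 g) (hlt : ∀ x, ‖g x‖ < 1) :
    ∃ x, g x = x := by
  by_contra! hne
  set u : E → E := fun x => x - g x with hu
  have hu0 : ∀ x, 0 < ‖u x‖ := fun x => norm_pos_iff.2 (sub_ne_zero.2 (hne x).symm)
  set D : E → ℝ := fun x => inner ℝ x (u x) ^ 2 + ‖u x‖ ^ 2 * (1 - ‖x‖ ^ 2) with hD
  have hinner : ∀ x ∈ sphere (0 : E) 1, 0 < inner ℝ x (u x) := by
    intro x hx
    have hx1 : ‖x‖ = 1 := by simpa using hx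
    have h1 : inner ℝ x (g x) < 1 := (real_inner_le_norm x (g x)).trans_lt (by
      rw [hx1, one_mul]; exact hlt x)
    rw [hu, inner_sub_right, real_inner_self_eq_norm_sq, hx1]
    linarith
  have hDpos : ∀ x ∈ closedBall (0 : E) 1, 0 < D x := by
    intro x hx
    rcases (mem_closedBall_zero_iff.1 hx).lt_or_eq with h | h
    · have h1 : 0 < 1 - ‖x‖ ^ 2 := by nlinarith [norm_nonneg x]
      have := mul_pos (pow_pos (hu0 x) 2) h1
      positivity
    · have := hinner x (by simpa using h)
      simp only [hD, h]
      nlinarith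
  set l : E → ℝ := fun x => (-inner ℝ x (u x) + √(D x)) / ‖u x‖ ^ 2 with hl
  have hus : ContDiff ℝ 1 u := contDiff_id.sub hg
  have hDs : ContDiff ℝ 1 D := ((contDiff_id.inner ℝ hus).pow 2).add
    ((hus.norm_sq ℝ).mul (contDiff_const.sub (contDiff_id.norm_sq ℝ)))
  refine not_contDiffAt_retraction_sphere (f := fun x => x + l x • u x) (fun x hx => ?_)
    (fun x hx => ?_) (fun x hx => ?_)
  · have hls : ContDiffAt ℝ 1 l x :=
      ((contDiff_id.inner ℝ hus).neg.contDiffAt.add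
        (hDs.contDiffAt.sqrt (hDpos x hx).ne')).div (hus.norm_sq ℝ).contDiffAt
        (pow_pos (hu0 x) 2).ne'
    exact contDiffAt_id.add (hls.smul hus.contDiffAt)
  · have hn : ‖x + l x • u x‖ ^ 2 = 1 := by
      rw [norm_add_sq_real, inner_smul_right, norm_smul, mul_pow, Real.norm_eq_abs, sq_abs]
      have hs : √(D x) ^ 2 = D x := Real.sq_sqrt (hDpos x hx).le
      have hlu : l x * ‖u x‖ ^ 2 = -inner ℝ x (u x) + √(D x) :=
        div_mul_cancel₀ _ (pow_pos (hu0 x) 2).ne'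
      have hmul : ‖u x‖ ^ 2 * (‖x‖ ^ 2 + 2 * (l x * inner ℝ x (u x)) + l x ^ 2 * ‖u x‖ ^ 2) =
          ‖u x‖ ^ 2 * 1 := by
        have : ‖u x‖ ^ 2 * (‖x‖ ^ 2 + 2 * (l x * inner ℝ x (u x)) + l x ^ 2 * ‖u x‖ ^ 2) =
            ‖u x‖ ^ 2 * ‖x‖ ^ 2 + 2 * (l x * ‖u x‖ ^ 2) * inner ℝ x (u x)
              + (l x * ‖u x‖ ^ 2) ^ 2 := by ring
        rw [this, hlu]
        simp only [hD] at hs ⊢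
        linear_combination hs
      exact mul_left_cancel₀ (pow_pos (hu0 x) 2).ne' hmul
    rw [mem_sphere_zero_iff_norm]
    exact (pow_eq_one_iff_of_nonneg (norm_nonneg _) two_ne_zero).1 hn
  · have hx1 : ‖x‖ = 1 := by simpa using hx
    have hDx : √(D x) = inner ℝ x (u x) := by
      simp only [hD, hx1]
      rw [one_pow, sub_self, mul_zero, add_zero, Real.sqrt_sq (hinner x hx).le]
    simp [hl, hDx]

/-- **Brouwer's fixed point theorem** for bounded continuous self-maps of a Euclidean space. -/
theorem exists_fixedPoint_of_continuous_of_bounded {E : Type*} [NormedAddCommGroup E]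
    [InnerProductSpace ℝ E] [FiniteDimensional ℝ E] {f : E → E} (hf : Continuous f) {r : ℝ}
    (hr : ∀ x, ‖f x‖ ≤ r) : ∃ x, f x = x := by
  have hr0 : 0 ≤ r := (norm_nonneg _).trans (hr 0)
  set c := r + 1 with hc
  have hc0 : 0 < c := by positivity
  set F : E → E := fun x => c⁻¹ • f (c • x) with hF
  have hFc : Continuous F := (hf.comp (continuous_const_smul c)).const_smul c⁻¹
  have hFr : ∀ x, ‖F x‖ ≤ r / c := fun x => by
    rw [hF, norm_smul, norm_inv, Real.norm_of_nonneg hc0.le, inv_mul_eq_div]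
    gcongr
    exact hr _
  have hrc : r / c < 1 := (div_lt_one hc0).2 (by linarith)
  suffices ∃ x, F x = x by
    obtain ⟨x, hx⟩ := this
    exact ⟨c • x, (inv_smul_eq_iff₀ hc0.ne').1 hx⟩
  by_contra! hne
  obtain ⟨x₀, -, hx₀⟩ := (isCompact_closedBall (0 : E) 1).exists_isMinOn ⟨0, by simp⟩
    (hFc.dist continuous_id).continuousOn
  have hδ : 0 < dist (F x₀) x₀ := dist_pos.2 (hne x₀)
  obtain ⟨g, hg, hgF, -⟩ := hFc.exists_contDiff_approx 1
    (continuous_const (y := min (dist (F x₀) x₀) (1 - r / c)))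
    (fun _ => lt_min hδ (by linarith))
  have hg1 : ∀ x, ‖g x‖ < 1 := fun x => by
    have h1 := (hgF x).trans_le (min_le_right _ _)
    have h2 := norm_le_norm_add_norm_sub' (g x) (F x)
    rw [← dist_eq_norm] at h2
    linarith [hFr x]
  obtain ⟨x, hx⟩ := exists_fixedPoint_of_contDiff hg hg1
  have hxb : x ∈ closedBall (0 : E) 1 := by
    rw [mem_closedBall_zero_iff, ← hx]
    exact (hg1 x).le
  have h1 := (hgF x).trans_le (min_le_left _ _)
  have h2 : dist (F x₀) x₀ ≤ dist (F x) x := hx₀ hxb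
  rw [hx, dist_comm] at h1
  exact h2.not_gt h1

theorem exists_dist_le_of_continuous_of_mapsTo_compact {H : Type*} [NormedAddCommGroup H]
    [NormedSpace ℝ H] {F : H → H} (hF : Continuous F) {K : Set H} (hK : IsCompact K)
    (hFK : ∀ x, F x ∈ K) {ε : ℝ} (hε : 0 < ε) : ∃ x, dist x (F x) ≤ ε := by
  obtain ⟨t, -, htfin, ht⟩ := hK.finite_cover_balls hε
  lift t to Finset H using htfin
  set w : t → H → ℝ := fun i z => max 0 (ε - dist z i) with hw
  have hw0 : ∀ i z, 0 ≤ w i z := fun i z => le_max_left _ _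
  have hwc : ∀ i, Continuous (w i) := fun i =>
    continuous_const.max (continuous_const.sub (continuous_id.dist continuous_const))
  set W : H → ℝ := fun z => ∑ i, w i z with hW
  have hWc : Continuous W := continuous_finsetSum _ fun i _ => hwc i
  have hW0 : ∀ z ∈ K, 0 < W z := by
    intro z hz
    obtain ⟨y, hy, hzy⟩ := mem_iUnion₂.1 (ht hz)
    refine Finset.sum_pos' (fun i _ => hw0 i z) ⟨⟨y, hy⟩, Finset.mem_univ _, ?_⟩
    exact lt_max_of_lt_right (sub_pos.2 hzy)
  set p : EuclideanSpace ℝ t → H := fun a => ∑ i, a i • (i : H) with hp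
  have hpc : Continuous p := by fun_prop
  set φ : EuclideanSpace ℝ t → EuclideanSpace ℝ t :=
    fun a => WithLp.toLp 2 fun i => w i (F (p a)) / W (F (p a)) with hφ
  have hφc : Continuous φ := by
    refine (PiLp.continuous_toLp 2 _).comp (continuous_pi fun i => ?_)
    exact ((hwc i).comp (hF.comp hpc)).div (hWc.comp (hF.comp hpc)) fun a => (hW0 _ (hFK _)).ne'
  have hφb : ∀ a, ‖φ a‖ ≤ √(∑ _i : t, (1 : ℝ)) := by
    intro a
    rw [EuclideanSpace.norm_eq]
    refine Real.sqrt_le_sqrt (Finset.sum_le_sum fun i _ => ?_)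
    have hpos := hW0 _ (hFK (p a))
    have h0 : 0 ≤ w i (F (p a)) / W (F (p a)) := div_nonneg (hw0 _ _) hpos.le
    rw [Real.norm_of_nonneg h0]
    exact pow_le_one₀ h0 ((div_le_one hpos).2
      (Finset.single_le_sum (fun j _ => hw0 j _) (Finset.mem_univ i)))
  obtain ⟨a, ha⟩ := exists_fixedPoint_of_continuous_of_bounded hφc hφb
  refine ⟨p a, ?_⟩
  set z := F (p a) with hz
  have hpos : 0 < W z := hW0 z (hFK _)
  have hai : ∀ i, a i = w i z / W z := fun i => by
    conv_lhs => rw [← ha]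
  have ha0 : ∀ i, 0 ≤ a i := fun i => by rw [hai]; exact div_nonneg (hw0 _ _) hpos.le
  have hasum : ∑ i, a i = 1 := by
    simp_rw [hai, ← Finset.sum_div]
    exact div_self hpos.ne'
  have hsub : p a - z = ∑ i, a i • ((i : H) - z) := by
    simp_rw [smul_sub, Finset.sum_sub_distrib, ← Finset.sum_smul, hasum, one_smul, hp]
  rw [dist_eq_norm, hsub]
  calc ‖∑ i, a i • ((i : H) - z)‖ ≤ ∑ i, a i * ε := norm_sum_le_of_le _ fun i _ => by
        rw [norm_smul, Real.norm_of_nonneg (ha0 i)]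
        rcases le_or_gt ε (dist z i) with h | h
        · have : a i = 0 := by rw [hai, hw]; simp [h]
          simp [this]
        · rw [dist_comm, dist_eq_norm] at h
          exact mul_le_mul_of_nonneg_left h.le (ha0 i)
    _ = ε := by rw [← Finset.sum_mul, hasum, one_mul]

/-- **Schauder's fixed point theorem** for continuous self-maps with relatively compact range. -/
theorem exists_fixedPoint_of_continuous_of_mapsTo_compact {H : Type*} [NormedAddCommGroup H]
    [NormedSpace ℝ H] {F : H → H} (hF : Continuous F) {K : Set H} (hK : IsCompact K)
    (hFK : ∀ x, F x ∈ K) : ∃ x, F x = x := by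
  choose x hx using fun n : ℕ => exists_dist_le_of_continuous_of_mapsTo_compact hF hK hFK
    (Nat.one_div_pos_of_nat (α := ℝ) (n := n))
  obtain ⟨z, -, θ, hθ, hz⟩ := hK.tendsto_subseq fun n => hFK (x n)
  have hd : Filter.Tendsto (fun n => dist (F (x (θ n))) (x (θ n))) Filter.atTop (𝓝 0) :=
    squeeze_zero (fun _ => dist_nonneg) (fun n => by rw [dist_comm]; exact hx (θ n))
      (tendsto_one_div_add_atTop_nhds_zero_nat.comp hθ.tendsto_atTop)
  have hxz : Filter.Tendsto (fun n => x (θ n)) Filter.atTop (𝓝 z) := hz.congr_dist hd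
  exact ⟨z, tendsto_nhds_unique ((hF.tendsto z).comp hxz) hz⟩

theorem stmt_16 {H : Type*} [NormedAddCommGroup H] [NormedSpace ℝ H]
    [CompleteSpace H] (S : H → H) (hcont : Continuous S)
    (hcompact : ∀ s : Set H, Bornology.IsBounded s →
      IsCompact (closure (S '' s)))
    (hR : ∃ R : ℝ, 0 < R ∧ ∀ t : ℝ, t ∈ Set.Icc (0 : ℝ) 1 →
      ∀ u : H, u = t • S u → ‖u‖ < R) :
    ∃ u : H, S u = u := by
  obtain ⟨R, hR0, hR⟩ := hR
  have hmax : ∀ u : H, 0 < max R ‖u‖ := fun u => lt_max_of_lt_left hR0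
  set P : H → H := fun u => (R / max R ‖u‖) • u with hP
  have hPc : Continuous P :=
    (continuous_const.div (continuous_const.max continuous_norm) fun u => (hmax u).ne').smul
      continuous_id
  have hPnorm : ∀ u, ‖P u‖ = R / max R ‖u‖ * ‖u‖ := fun u => by
    rw [hP, norm_smul, Real.norm_of_nonneg (div_nonneg hR0.le (hmax u).le)]
  have hPball : ∀ u, ‖P u‖ ≤ R := fun u => by
    rw [hPnorm, div_mul_eq_mul_div]
    exact div_le_of_le_mul₀ (hmax u).le hR0.le
      (mul_le_mul_of_nonneg_left (le_max_right _ _) hR0.le)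
  have hPid : ∀ u, ‖u‖ ≤ R → P u = u := fun u hu => by
    rw [hP]
    simp only [max_eq_left hu, div_self hR0.ne', one_smul]
  obtain ⟨u, hu⟩ := exists_fixedPoint_of_continuous_of_mapsTo_compact
    (F := P ∘ S ∘ P) (hPc.comp (hcont.comp hPc))
    ((hcompact (closedBall 0 R) isBounded_closedBall).image hPc)
    (fun x => mem_image_of_mem P (subset_closure
      (mem_image_of_mem S (mem_closedBall_zero_iff.2 (hPball x)))))
  have huR : ‖u‖ ≤ R := hu ▸ hPball _
  replace hu : P (S u) = u := by simpa [hPid u huR] using hu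
  have hlt : ‖u‖ < R := hR (R / max R ‖S u‖)
    ⟨div_nonneg hR0.le (hmax _).le, (div_le_one (hmax _)).2 (le_max_left _ _)⟩ u hu.symm
  refine ⟨u, ?_⟩
  rcases le_or_gt ‖S u‖ R with h | h
  · rwa [hPid _ h] at hu
  · have := hPnorm (S u)
    rw [hu, max_eq_right h.le, div_mul_cancel₀ _ (hR0.trans h).ne'] at this
    exact absurd this hlt.ne
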